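/- arXiv:1811.06887 — 3 statements merged into one kernel-verified Lean document; each statement's English description precedes it below -/
import Mathlib

section
/- A map P : E₁×⋯×Eₘ → F is a continuous (n₁,…,nₘ)-homogeneous polynomial if and only if there exists a continuous (n₁+⋯+nₘ)-linear map T : E₁^{n₁}×⋯×Eₘ^{nₘ} → F such that P(x₁,…,xₘ) = T(x₁,…,x₁,…,xₘ,…,xₘ) (each xᵢ repeated nᵢ times) for all x₁ ∈ E₁,…,xₘ ∈ Eₘ. -/
open scoped BigOperators

/-- `P : E₁ × ⋯ × Eₘ → F` is a continuous `(n 1, …, n m)`-homogeneous polynomial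
(multipolynomial): for each coordinate `i` and each choice of the other variables,
the map `y ↦ P (x with i-th entry y)` is a continuous `n i`-homogeneous polynomial,
i.e. the diagonal of a continuous `n i`-linear map `Eᵢ^{n i} → F`. -/
def IsMultipolynomial (𝕜 : Type*) [RCLike 𝕜] {m : ℕ} (n : Fin m → ℕ)
    {E : Fin m → Type*} [∀ i, NormedAddCommGroup (E i)] [∀ i, NormedSpace 𝕜 (E i)]
    {F : Type*} [NormedAddCommGroup F] [NormedSpace 𝕜 F]
    (P : ((i : Fin m) → E i) → F) : Prop :=
  ∀ (i : Fin m) (x : (j : Fin m) → E j),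
    ∃ A : ContinuousMultilinearMap 𝕜 (fun _ : Fin (n i) => E i) F,
      ∀ y : E i, P (Function.update x i y) = A (fun _ => y)

open Finset in
/-- The polarization formula: the alternating sum of the diagonal values of a multilinear map is
its symmetrization. -/
theorem MultilinearMap.sum_neg_one_pow_smul_map_diagonal {R ι M N : Type*} [CommRing R]
    [Fintype ι] [DecidableEq ι] [AddCommGroup M] [Module R M] [AddCommGroup N] [Module R N]
    (A : MultilinearMap R (fun _ : ι => M) N) (y : ι → M) :
    ∑ t : Finset ι, (-1 : R) ^ #t • A (fun _ => ∑ j ∈ tᶜ, y j) =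
      ∑ σ : Equiv.Perm ι, A (fun j => y (σ j)) := by
  have expand (t : Finset ι) : (-1 : R) ^ #t • A (fun _ => ∑ j ∈ tᶜ, y j) =
      ∑ f : ι → ι, if t ⊆ (univ.image f)ᶜ then (-1 : R) ^ #t • A (fun j => y (f j)) else 0 := by
    rw [A.map_sum_finset (fun _ => y) (fun _ => tᶜ), smul_sum, ← sum_filter]
    refine sum_congr ?_ fun _ _ => rfl
    ext f
    simp only [Fintype.mem_piFinset, mem_compl, mem_filter, mem_univ, true_and, subset_iff,
      mem_image, not_exists]
    exact ⟨fun h a ha b hb => h b (hb ▸ ha), fun h a ha => h ha a rfl⟩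
  have collect (f : ι → ι) :
      (∑ t : Finset ι, if t ⊆ (univ.image f)ᶜ then (-1 : R) ^ #t • A (fun j => y (f j)) else 0) =
        if Function.Bijective f then A (fun j => y (f j)) else 0 := by
    rw [← sum_filter, ← sum_smul]
    have hfilter : univ.filter (· ⊆ (univ.image f)ᶜ) = ((univ.image f)ᶜ).powerset := by
      ext; simp
    have hsum := congrArg (Int.cast : ℤ → R)
      (sum_powerset_neg_one_pow_card (x := (univ.image f)ᶜ))
    push_cast at hsum
    have hbij : (univ.image f)ᶜ = ∅ ↔ Function.Bijective f := by
      rw [compl_eq_empty_iff, ← Finite.surjective_iff_bijective]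
      simp [Finset.ext_iff, Function.Surjective]
    rw [hfilter, hsum]
    simp only [hbij]
    split_ifs <;> simp
  simp_rw [expand]
  rw [sum_comm]
  simp_rw [collect]
  rw [← sum_filter]
  refine (sum_bij (fun (σ : Equiv.Perm ι) _ => ⇑σ) (fun σ _ => by simp)
    (fun _ _ _ _ h => DFunLike.coe_injective h)
    (fun f hf => ⟨Equiv.ofBijective f (by simpa using hf), mem_univ _, rfl⟩)
    (fun _ _ => rfl)).symm

open Finset in
/-- The alternating sum of `n`-th powers over subsets is `n!`. -/
theorem sum_neg_one_pow_mul_card_compl_pow (R ι : Type*) [CommRing R] [Fintype ι]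
    [DecidableEq ι] :
    ∑ t : Finset ι, (-1 : R) ^ #t * (#tᶜ : R) ^ Fintype.card ι = (Fintype.card ι).factorial := by
  simpa [Fintype.card_perm] using
    (MultilinearMap.mkPiAlgebra R ι R).sum_neg_one_pow_smul_map_diagonal (fun _ => 1)

/-- A separately continuous multilinear map on Banach spaces is bounded on the product of the
closed unit balls. -/
theorem MultilinearMap.exists_bound_unitBall_of_separately_continuous {𝕜 ι : Type*} [RCLike 𝕜]
    [Fintype ι] [DecidableEq ι] {E : ι → Type*} [∀ i, NormedAddCommGroup (E i)]
    [∀ i, NormedSpace 𝕜 (E i)] [∀ i, CompleteSpace (E i)]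
    {F : Type*} [NormedAddCommGroup F] [NormedSpace 𝕜 F]
    (f : MultilinearMap 𝕜 E F)
    (hf : ∀ x i, Continuous fun v => f (Function.update x i v)) :
    ∃ C, ∀ x, (∀ i, ‖x i‖ ≤ 1) → ‖f x‖ ≤ C := by
  suffices H : ∀ (s : Finset ι) (x : ∀ i, E i),
      ∃ C, ∀ y, (∀ i ∈ s, ‖y i‖ ≤ 1) → (∀ i ∉ s, y i = x i) → ‖f y‖ ≤ C by
    obtain ⟨C, hC⟩ := H Finset.univ 0
    exact ⟨C, fun x hx => hC x (fun i _ => hx i) (by simp)⟩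
  intro s
  induction s using Finset.induction_on with
  | empty =>
    refine fun x => ⟨‖f x‖, fun y _ hy => ?_⟩
    rw [show y = x from funext fun i => hy i (by simp)]
  | insert a s ha ih =>
    intro x
    let g : {y : ∀ i, E i // (∀ i ∈ s, ‖y i‖ ≤ 1) ∧ ∀ i ∉ insert a s, y i = x i} → (E a →L[𝕜] F) :=
      fun y => ⟨f.toLinearMap y.1 a, hf y.1 a⟩
    obtain ⟨C, hC⟩ := banach_steinhaus (g := g) fun v => by
      obtain ⟨C, hC⟩ := ih (Function.update x a v)
      refine ⟨C, fun y => hC _ (fun i hi => ?_) (fun i hi => ?_)⟩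
      · rw [Function.update_of_ne (ne_of_mem_of_not_mem hi ha)]
        exact y.2.1 i hi
      · rcases eq_or_ne i a with rfl | hia
        · simp
        · rw [Function.update_of_ne hia, Function.update_of_ne hia]
          exact y.2.2 i (by simp [hia, hi])
    refine ⟨C, fun y hy hyx => ?_⟩
    have hle := hC ⟨y, fun i hi => hy i (Finset.mem_insert_of_mem hi), hyx⟩
    have happly : g ⟨y, fun i hi => hy i (Finset.mem_insert_of_mem hi), hyx⟩ (y a) = f y := by
      change f (Function.update y a (y a)) = f y
      rw [Function.update_eq_self]
    rw [← happly]
    exact (ContinuousLinearMap.le_of_opNorm_le_of_le _ hle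
      (hy a (Finset.mem_insert_self a s))).trans_eq (mul_one C)

/-- A separately continuous multilinear map on Banach spaces is continuous. -/
theorem MultilinearMap.continuous_of_separately_continuous {𝕜 ι : Type*} [RCLike 𝕜]
    [Fintype ι] [DecidableEq ι] {E : ι → Type*} [∀ i, NormedAddCommGroup (E i)]
    [∀ i, NormedSpace 𝕜 (E i)] [∀ i, CompleteSpace (E i)]
    {F : Type*} [NormedAddCommGroup F] [NormedSpace 𝕜 F]
    (f : MultilinearMap 𝕜 E F)
    (hf : ∀ x i, Continuous fun v => f (Function.update x i v)) :
    Continuous f := by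
  obtain ⟨C, hC⟩ := f.exists_bound_unitBall_of_separately_continuous hf
  refine f.continuous_of_bound C fun x => ?_
  have hnorm (i : ι) : ‖((‖x i‖⁻¹ : ℝ) : 𝕜) • x i‖ ≤ 1 := by
    rw [norm_smul, RCLike.norm_ofReal, abs_of_nonneg (by positivity)]
    exact inv_mul_le_one
  have hx : x = fun i => ((‖x i‖ : ℝ) : 𝕜) • ((‖x i‖⁻¹ : ℝ) : 𝕜) • x i := by
    funext i
    rcases eq_or_ne (x i) 0 with h | h
    · simp [h]
    · rw [smul_smul, ← RCLike.ofReal_mul, mul_inv_cancel₀ (norm_ne_zero_iff.mpr h),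
        RCLike.ofReal_one, one_smul]
  calc ‖f x‖ = (∏ i, ‖x i‖) * ‖f fun i => ((‖x i‖⁻¹ : ℝ) : 𝕜) • x i‖ := by
        conv_lhs => rw [hx, f.map_smul_univ, norm_smul, norm_prod]
        simp
    _ ≤ (∏ i, ‖x i‖) * C := by gcongr; exact hC _ hnorm
    _ = C * ∏ i, ‖x i‖ := mul_comm _ _

namespace IsMultipolynomial

variable {𝕜 : Type*} [RCLike 𝕜] {m : ℕ} {n : Fin m → ℕ} {E : Fin m → Type*}
  [∀ i, NormedAddCommGroup (E i)] [∀ i, NormedSpace 𝕜 (E i)]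
  {F : Type*} [NormedAddCommGroup F] [NormedSpace 𝕜 F] {P : ((i : Fin m) → E i) → F}

/-- A multipolynomial is homogeneous in each variable. -/
theorem map_update_smul (hP : IsMultipolynomial 𝕜 n P) (x : ∀ i, E i) (i : Fin m) (c : 𝕜)
    (v : E i) :
    P (Function.update x i (c • v)) = c ^ n i • P (Function.update x i v) := by
  obtain ⟨A, hA⟩ := hP i x
  rw [hA, hA]
  simpa using A.map_smul_univ (fun _ => c) (fun _ => v)

/-- A multipolynomial is jointly homogeneous. -/
theorem map_smul (hP : IsMultipolynomial 𝕜 n P) (c : Fin m → 𝕜) (x : ∀ i, E i) :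
    P (fun i => c i • x i) = (∏ i, c i ^ n i) • P x := by
  suffices H : ∀ s : Finset (Fin m),
      P (s.piecewise (fun i => c i • x i) x) = (∏ i ∈ s, c i ^ n i) • P x by
    simpa using H Finset.univ
  intro s
  induction s using Finset.induction_on with
  | empty => simp
  | insert a s ha ih =>
    have hself : Function.update (s.piecewise (fun i => c i • x i) x) a (x a) =
        s.piecewise (fun i => c i • x i) x := by
      rw [Function.update_eq_self_iff, Finset.piecewise_eq_of_notMem _ _ _ ha]
    rw [Finset.piecewise_insert, hP.map_update_smul, hself, ih, Finset.prod_insert ha, mul_smul]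

variable (𝕜 n P) in
/-- The alternating sum over subsets that polarizes a map in several variables. -/
noncomputable def polarSum (y : ∀ p : Σ i : Fin m, Fin (n i), E p.1) : F :=
  ∑ s : ∀ i, Finset (Fin (n i)),
    (∏ i, (-1 : 𝕜) ^ (s i).card) • P (fun i => ∑ j ∈ (s i)ᶜ, y ⟨i, j⟩)

theorem polarSum_diagonal (hP : IsMultipolynomial 𝕜 n P) (x : ∀ i, E i) :
    polarSum 𝕜 n P (fun p => x p.1) = (∏ i, ((n i).factorial : 𝕜)) • P x := by
  have hterm (s : ∀ i, Finset (Fin (n i))) :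
      (∏ i, (-1 : 𝕜) ^ (s i).card) • P (fun i => ∑ _j ∈ (s i)ᶜ, x i) =
        (∏ i, (-1 : 𝕜) ^ (s i).card * ((s i)ᶜ.card : 𝕜) ^ n i) • P x := by
    simp_rw [Finset.sum_const, ← Nat.cast_smul_eq_nsmul 𝕜]
    rw [hP.map_smul, smul_smul, Finset.prod_mul_distrib]
  simp only [polarSum, hterm]
  rw [← Finset.sum_smul,
    ← Fintype.prod_sum fun i (t : Finset (Fin (n i))) =>
      (-1 : 𝕜) ^ t.card * (tᶜ.card : 𝕜) ^ n i]
  congr 1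
  refine Finset.prod_congr rfl fun i _ => ?_
  simpa using sum_neg_one_pow_mul_card_compl_pow 𝕜 (Fin (n i))

/-- With all other blocks of variables fixed, the polarizing sum of a multipolynomial is a
continuous multilinear map in one block. -/
theorem exists_polarSum_eq (hP : IsMultipolynomial 𝕜 n P)
    (z : ∀ i, Fin (n i) → E i) (i : Fin m) :
    ∃ B : ContinuousMultilinearMap 𝕜 (fun _ : Fin (n i) => E i) F,
      ∀ v, polarSum 𝕜 n P (Sigma.uncurry (Function.update z i v)) = B v := by
  let X (r : ∀ k : {k // k ≠ i}, Finset (Fin (n k))) : ∀ k, E k :=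
    fun k => if h : k = i then 0 else ∑ j ∈ (r ⟨k, h⟩)ᶜ, z k j
  choose A hA using fun r => hP i (X r)
  refine ⟨∑ r : ∀ k : {k // k ≠ i}, Finset (Fin (n k)), (∏ k, (-1 : 𝕜) ^ (r k).card) •
    ∑ σ : Equiv.Perm (Fin (n i)), (A r).domDomCongr σ, fun v => ?_⟩
  have hpol (r) := (A r).toMultilinearMap.sum_neg_one_pow_smul_map_diagonal v
  simp only [ContinuousMultilinearMap.coe_coe, ← hA] at hpol
  simp only [sum_apply, smul_apply,
    ContinuousMultilinearMap.domDomCongr_apply, ← hpol]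
  rw [polarSum, ← (Equiv.piSplitAt i fun k => Finset (Fin (n k))).symm.sum_comp,
    Fintype.sum_prod_type_right]
  refine Finset.sum_congr rfl fun r _ => ?_
  rw [Finset.smul_sum]
  refine Finset.sum_congr rfl fun t _ => ?_
  rw [smul_smul]
  congr 1
  · rw [Fintype.prod_eq_mul_prod_subtype_ne _ i, mul_comm]
    congr 1
    · refine Finset.prod_congr rfl fun k _ => ?_
      simp [Equiv.piSplitAt, k.2]
    · simp [Equiv.piSplitAt]
  · congr 1
    funext k
    rcases eq_or_ne k i with rfl | hk
    · simp [Equiv.piSplitAt, Sigma.uncurry]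
    · simp [Equiv.piSplitAt, Sigma.uncurry, hk, X]

theorem exists_polarSum_update_eq (hP : IsMultipolynomial 𝕜 n P)
    (y : ∀ p : Σ i : Fin m, Fin (n i), E p.1) (p : Σ i : Fin m, Fin (n i)) :
    ∃ L : E p.1 →L[𝕜] F, ∀ v, polarSum 𝕜 n P (Function.update y p v) = L v := by
  let z : ∀ i, Fin (n i) → E i := Sigma.curry y
  obtain ⟨B, hB⟩ := hP.exists_polarSum_eq z p.1
  refine ⟨B.toContinuousLinearMap (z p.1) p.2, fun v => ?_⟩
  have h := hB (Function.update (z p.1) p.2 v)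
  rwa [← Sigma.curry_update (γ := fun i (_ : Fin (n i)) => E i), Sigma.uncurry_curry] at h

variable [∀ i, CompleteSpace (E i)]

theorem exists_continuousMultilinearMap (hP : IsMultipolynomial 𝕜 n P) :
    ∃ T : ContinuousMultilinearMap 𝕜 (fun p : Σ i : Fin m, Fin (n i) => E p.1) F,
      ∀ x : (i : Fin m) → E i, P x = T (fun p => x p.1) := by
  let S : MultilinearMap 𝕜 (fun p : Σ i : Fin m, Fin (n i) => E p.1) F :=
    MultilinearMap.mk' (polarSum 𝕜 n P)
      (fun y p v w => by
        obtain ⟨L, hL⟩ := hP.exists_polarSum_update_eq y p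
        simp [hL])
      (fun y p c v => by
        obtain ⟨L, hL⟩ := hP.exists_polarSum_update_eq y p
        simp [hL])
  have hS : Continuous S := S.continuous_of_separately_continuous fun y p => by
    obtain ⟨L, hL⟩ := hP.exists_polarSum_update_eq y p
    exact L.continuous.congr fun v => (hL v).symm
  refine ⟨(∏ i, ((n i).factorial : 𝕜))⁻¹ • ⟨S, hS⟩, fun x => ?_⟩
  have hne : (∏ i, ((n i).factorial : 𝕜)) ≠ 0 :=
    Finset.prod_ne_zero_iff.mpr fun i _ => Nat.cast_ne_zero.mpr (n i).factorial_ne_zero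
  change P x = (∏ i, ((n i).factorial : 𝕜))⁻¹ • polarSum 𝕜 n P (fun p => x p.1)
  rw [hP.polarSum_diagonal, inv_smul_smul₀ hne]

end IsMultipolynomial

/-- The diagonal of a continuous multilinear map is a multipolynomial. -/
theorem ContinuousMultilinearMap.isMultipolynomial_diagonal {𝕜 : Type*} [RCLike 𝕜] {m : ℕ}
    {n : Fin m → ℕ} {E : Fin m → Type*} [∀ i, NormedAddCommGroup (E i)]
    [∀ i, NormedSpace 𝕜 (E i)] {F : Type*} [NormedAddCommGroup F] [NormedSpace 𝕜 F]
    (T : ContinuousMultilinearMap 𝕜 (fun p : Σ i : Fin m, Fin (n i) => E p.1) F) :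
    IsMultipolynomial 𝕜 n fun x => T (fun p => x p.1) := by
  intro i x
  let W (v : Fin (n i) → E i) : ∀ p : Σ i : Fin m, Fin (n i), E p.1 :=
    Sigma.uncurry (Function.update (fun k _ => x k) i v)
  have hW (v : Fin (n i) → E i) (j : Fin (n i)) (a : E i) :
      W (Function.update v j a) = Function.update (W v) ⟨i, j⟩ a := by
    have h := Sigma.curry_update (γ := fun i (_ : Fin (n i)) => E i) ⟨i, j⟩ (W v) a
    simp only [W, Sigma.curry_uncurry, Function.update_self, Function.update_idem] at h
    simp only [W, ← h, Sigma.uncurry_curry]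
  have hcont : Continuous W := by
    refine continuous_pi fun p => ?_
    have hupdate : Continuous (Function.update (fun k (_ : Fin (n k)) => x k) i) :=
      continuous_const.update i continuous_id
    exact (continuous_apply p.2).comp ((continuous_apply p.1).comp hupdate)
  refine ⟨⟨MultilinearMap.mk' (fun v => T (W v)) (fun v j a b => ?_) (fun v j c a => ?_),
    T.cont.comp hcont⟩, fun y => ?_⟩
  · simp only [hW, T.map_update_add]
  · simp only [hW, T.map_update_smul]
  · refine congrArg T (funext fun p => ?_)
    rcases eq_or_ne p.1 i with h | h
    · obtain ⟨k, j⟩ := p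
      obtain rfl : k = i := h
      simp [W, Sigma.uncurry]
    · simp [W, Sigma.uncurry, h]

/-- A map `P : E₁ × ⋯ × Eₘ → F` is a continuous `(n₁,…,nₘ)`-homogeneous polynomial if and
only if there is a continuous `(n₁ + ⋯ + nₘ)`-linear map `T : E₁^{n₁} × ⋯ × Eₘ^{nₘ} → F`
such that `P (x₁, …, xₘ) = T (x₁, …, x₁, …, xₘ, …, xₘ)` (each `xᵢ` repeated `nᵢ` times). -/
theorem multipolynomial_iff_exists_multilinear
    {𝕜 : Type*} [RCLike 𝕜] {m : ℕ} (n : Fin m → ℕ) (hn : ∀ i, 0 < n i)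
    {E : Fin m → Type*} [∀ i, NormedAddCommGroup (E i)] [∀ i, NormedSpace 𝕜 (E i)]
    [∀ i, CompleteSpace (E i)]
    {F : Type*} [NormedAddCommGroup F] [NormedSpace 𝕜 F] [CompleteSpace F]
    (P : ((i : Fin m) → E i) → F) :
    IsMultipolynomial 𝕜 n P ↔
      ∃ T : ContinuousMultilinearMap 𝕜 (fun p : Σ i : Fin m, Fin (n i) => E p.1) F,
        ∀ x : (i : Fin m) → E i, P x = T (fun p => x p.1) := by
  refine ⟨fun hP => hP.exists_continuousMultilinearMap, fun ⟨T, hT⟩ => ?_⟩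
  obtain rfl : P = fun x => T (fun p => x p.1) := funext hT
  exact T.isMultipolynomial_diagonal
end

section
/- If E is a Banach space with dim E > 1, F is a nonzero Banach space, m ≥ 2, and n₁,…,nₘ are positive integers, then there exists a continuous (n₁+⋯+nₘ)-linear map T : E^{n₁+⋯+nₘ} → F that is (n₁,…,nₘ)-symmetric but is not symmetric (i.e., T is not invariant under some permutation of all n₁+⋯+nₘ variables); hence the space of symmetric continuous (n₁+⋯+nₘ)-linear maps is a proper subspace of the space of (n₁,…,nₘ)-symmetric ones. -/
open scoped BigOperators

/-- A continuous `(n₁ + ⋯ + nₘ)`-linear map `T : E₁^{n₁} × ⋯ × Eₘ^{nₘ} → F` is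
`(n₁,…,nₘ)`-symmetric if it is invariant under permuting, within each block `i`,
the `n i` variables from `E i`. -/
def BlockSymmetric {𝕜 : Type*} [RCLike 𝕜] {m : ℕ} {n : Fin m → ℕ}
    {E : Fin m → Type*} [∀ i, NormedAddCommGroup (E i)] [∀ i, NormedSpace 𝕜 (E i)]
    {F : Type*} [NormedAddCommGroup F] [NormedSpace 𝕜 F]
    (T : ContinuousMultilinearMap 𝕜 (fun p : Σ i : Fin m, Fin (n i) => E p.1) F) : Prop :=
  ∀ (σ : (i : Fin m) → Equiv.Perm (Fin (n i)))
    (x : (p : Σ i : Fin m, Fin (n i)) → E p.1),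
    T (fun p => x ⟨p.1, σ p.1 p.2⟩) = T x

/-- A continuous `(n₁ + ⋯ + nₘ)`-linear map `T : E^{n₁ + ⋯ + nₘ} → F` is symmetric if it is
invariant under every permutation of all of its `n₁ + ⋯ + nₘ` variables. -/
def FullySymmetric {𝕜 : Type*} [RCLike 𝕜] {m : ℕ} {n : Fin m → ℕ}
    {E : Type*} [NormedAddCommGroup E] [NormedSpace 𝕜 E]
    {F : Type*} [NormedAddCommGroup F] [NormedSpace 𝕜 F]
    (T : ContinuousMultilinearMap 𝕜 (fun _ : Σ i : Fin m, Fin (n i) => E) F) : Prop :=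
  ∀ (τ : Equiv.Perm (Σ i : Fin m, Fin (n i))) (x : (Σ i : Fin m, Fin (n i)) → E),
    T (fun p => x (τ p)) = T x

/-- In a normed space of dimension greater than one, there are two vectors `a`,
`b` and two functionals `f`, `g` such that `f` is `1` at `a` and `0` at `b`, and `g` is `1`
at `b`. -/
theorem exists_dual_eq_one_eq_zero_of_one_lt_rank {𝕜 E : Type*} [RCLike 𝕜]
    [NormedAddCommGroup E] [NormedSpace 𝕜 E] (hE : 1 < Module.rank 𝕜 E) :
    ∃ (a b : E) (f g : E →L[𝕜] 𝕜), f a = 1 ∧ f b = 0 ∧ g b = 1 := by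
  have : Nontrivial E := rank_pos_iff_nontrivial.mp (zero_lt_one.trans hE)
  obtain ⟨b, hb⟩ := exists_ne (0 : E)
  obtain ⟨a, hab⟩ := exists_linearIndependent_pair_of_one_lt_rank hE hb
  obtain ⟨g, hg⟩ := SeparatingDual.exists_eq_one (R := 𝕜) hb
  have ha : a - g a • b ≠ 0 := fun h ↦
    one_ne_zero (LinearIndependent.pair_iff.mp hab (-g a) 1 (by rw [← h]; module)).2
  obtain ⟨h, hh⟩ := SeparatingDual.exists_eq_one (R := 𝕜) ha
  refine ⟨a - g a • b, b, h - h b • g, g, ?_, ?_, hg⟩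
  · simp only [sub_apply, smul_apply, hh]
    simp [hg]
  · simp [hg]

/-- The continuous multilinear map `x ↦ (∏ p, φ p (x p)) • y`. -/
noncomputable def ContinuousMultilinearMap.prodDualSMul {𝕜 ι E F : Type*} [RCLike 𝕜] [Fintype ι]
    [NormedAddCommGroup E] [NormedSpace 𝕜 E] [NormedAddCommGroup F] [NormedSpace 𝕜 F]
    (φ : ι → E →L[𝕜] 𝕜) (y : F) : ContinuousMultilinearMap 𝕜 (fun _ : ι => E) F :=
  ((ContinuousMultilinearMap.mkPiAlgebra 𝕜 ι 𝕜).compContinuousLinearMap φ).smulRight y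

@[simp]
theorem ContinuousMultilinearMap.prodDualSMul_apply {𝕜 ι E F : Type*} [RCLike 𝕜] [Fintype ι]
    [NormedAddCommGroup E] [NormedSpace 𝕜 E] [NormedAddCommGroup F] [NormedSpace 𝕜 F]
    (φ : ι → E →L[𝕜] 𝕜) (y : F) (x : ι → E) :
    prodDualSMul φ y x = (∏ p, φ p (x p)) • y := by
  simp [prodDualSMul]

/-- A product of functionals that depend only on the block is block symmetric. -/
theorem blockSymmetric_prodDualSMul {𝕜 : Type*} [RCLike 𝕜] {m : ℕ} {n : Fin m → ℕ}
    {E F : Type*} [NormedAddCommGroup E] [NormedSpace 𝕜 E]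
    [NormedAddCommGroup F] [NormedSpace 𝕜 F] (φ : Fin m → E →L[𝕜] 𝕜) (y : F) :
    BlockSymmetric (E := fun _ : Fin m => E)
      (ContinuousMultilinearMap.prodDualSMul
        (fun p : Σ i : Fin m, Fin (n i) => φ p.1) y) := by
  intro σ x
  simp only [ContinuousMultilinearMap.prodDualSMul_apply]
  congr 1
  exact Equiv.prod_comp (Equiv.sigmaCongrRight σ) fun p ↦ φ p.1 (x p)

/-- If `dim E > 1`, `F ≠ 0`, `m ≥ 2` and `n₁, …, nₘ ≥ 1`, then there exists a continuous
`(n₁ + ⋯ + nₘ)`-linear map `T : E^{n₁ + ⋯ + nₘ} → F` that is `(n₁,…,nₘ)`-symmetric but not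
symmetric; hence the symmetric maps form a proper subspace of the `(n₁,…,nₘ)`-symmetric
ones. -/
theorem exists_blockSymmetric_not_symmetric
    {𝕜 : Type*} [RCLike 𝕜] {m : ℕ} (hm : 2 ≤ m) (n : Fin m → ℕ) (hn : ∀ i, 0 < n i)
    {E : Type*} [NormedAddCommGroup E] [NormedSpace 𝕜 E] [CompleteSpace E]
    (hE : 1 < Module.rank 𝕜 E)
    {F : Type*} [NormedAddCommGroup F] [NormedSpace 𝕜 F] [CompleteSpace F] [Nontrivial F] :
    ∃ T : ContinuousMultilinearMap 𝕜 (fun _ : Σ i : Fin m, Fin (n i) => E) F,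
      BlockSymmetric (E := fun _ : Fin m => E) T ∧ ¬ FullySymmetric T := by
  obtain ⟨a, b, f, g, hfa, hfb, hgb⟩ := exists_dual_eq_one_eq_zero_of_one_lt_rank hE
  obtain ⟨y, hy⟩ := exists_ne (0 : F)
  let i₀ : Fin m := ⟨0, by lia⟩
  let i₁ : Fin m := ⟨1, by lia⟩
  have hi : i₁ ≠ i₀ := by simp [i₀, i₁]
  let p₀ : Σ i : Fin m, Fin (n i) := ⟨i₀, ⟨0, hn i₀⟩⟩
  let p₁ : Σ i : Fin m, Fin (n i) := ⟨i₁, ⟨0, hn i₁⟩⟩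
  let φ : Fin m → E →L[𝕜] 𝕜 := fun i ↦ if i = i₀ then f else g
  let x : (Σ i : Fin m, Fin (n i)) → E := fun p ↦ if p.1 = i₀ then a else b
  refine ⟨ContinuousMultilinearMap.prodDualSMul (fun p ↦ φ p.1) y,
    blockSymmetric_prodDualSMul φ y, fun hsymm ↦ hy ?_⟩
  have h := hsymm (Equiv.swap p₀ p₁) x
  simp only [ContinuousMultilinearMap.prodDualSMul_apply] at h
  have h_one : ∏ p : Σ i : Fin m, Fin (n i), φ p.1 (x p) = 1 :=
    Finset.prod_eq_one fun p _ ↦ by by_cases hp : p.1 = i₀ <;> simp [φ, x, hp, hfa, hgb]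
  have h_zero : ∏ p, φ p.1 (x (Equiv.swap p₀ p₁ p)) = 0 :=
    Finset.prod_eq_zero (Finset.mem_univ p₀) (by
      rw [Equiv.swap_apply_left]
      simp [φ, x, p₀, p₁, hi, hfb])
  rw [h_one, h_zero, zero_smul, one_smul] at h
  exact h.symm
end

section
/- Let P : E₁×⋯×Eₘ → F be a continuous (n₁,…,nₘ)-homogeneous polynomial and let P̌ be its unique associated (n₁,…,nₘ)-symmetric continuous (n₁+⋯+nₘ)-linear map. Then ‖P‖ ≤ ‖P̌‖ ≤ (n₁^{n₁}⋯nₘ^{nₘ}/(n₁!⋯nₘ!)) ‖P‖. -/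
open scoped BigOperators

/-- The norm of a multipolynomial: `‖P‖ = sup {‖P x‖ : ‖xᵢ‖ ≤ 1, i = 1,…,m}`. -/
noncomputable def polyNorm {m : ℕ} {E : Fin m → Type*} [∀ i, NormedAddCommGroup (E i)]
    {F : Type*} [NormedAddCommGroup F]
    (P : ((i : Fin m) → E i) → F) : ℝ :=
  sSup {r : ℝ | ∃ x : (i : Fin m) → E i, (∀ i, ‖x i‖ ≤ 1) ∧ r = ‖P x‖}

section Polarization

variable {𝕜 : Type*} [RCLike 𝕜] {m : ℕ} {n : Fin m → ℕ}

/-- Signs indexed by a map that misses a point average out to zero. -/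
theorem sum_signs_eq_zero_of_notMem_range {ι : Type*} [Fintype ι] [DecidableEq ι]
    (φ : ι → ι) {q : ι} (hq : ∀ p, φ p ≠ q) :
    ∑ ε : ι → ℤˣ, (∏ p, ((ε p : ℤ) : 𝕜)) * ∏ p, ((ε (φ p) : ℤ) : 𝕜) = 0 := by
  rw [← self_eq_neg, ← Finset.sum_neg_distrib]
  refine Fintype.sum_equiv (Equiv.mulLeft (Pi.mulSingle q (-1))) _ _ fun ε => ?_
  have h₁ : ∏ p, (((Pi.mulSingle q (-1) : ι → ℤˣ) p : ℤ) : 𝕜) = -1 := by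
    rw [Finset.prod_eq_single q] <;> simp +contextual [Pi.mulSingle_eq_of_ne]
  simp [Pi.mulSingle_eq_of_ne (hq _), Finset.prod_mul_distrib, h₁]

/-- The signs of a permuted family cancel those of the family. -/
theorem sum_signs_of_perm {ι : Type*} [Fintype ι] [DecidableEq ι] (φ : Equiv.Perm ι) :
    ∑ ε : ι → ℤˣ, (∏ p, ((ε p : ℤ) : 𝕜)) * ∏ p, ((ε (φ p) : ℤ) : 𝕜) =
      Fintype.card (ι → ℤˣ) := by
  have h (ε : ι → ℤˣ) : (∏ p, ((ε p : ℤ) : 𝕜)) * ∏ p, ((ε (φ p) : ℤ) : 𝕜) = 1 := by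
    rw [Equiv.prod_comp φ fun p => ((ε p : ℤ) : 𝕜), ← Finset.prod_mul_distrib]
    refine Finset.prod_eq_one fun p _ => ?_
    rw [← Int.cast_mul, ← Units.val_mul, Int.units_mul_self]
    simp
  simp_rw [h]
  simp

variable {E : Fin m → Type*} [∀ i, NormedAddCommGroup (E i)] [∀ i, NormedSpace 𝕜 (E i)]
  {F : Type*} [NormedAddCommGroup F] [NormedSpace 𝕜 F]

/-- The polarization formula for block-symmetric multilinear maps. -/
theorem BlockSymmetric.polarization
    {T : ContinuousMultilinearMap 𝕜 (fun p : Σ i : Fin m, Fin (n i) => E p.1) F}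
    (hT : BlockSymmetric T) (x : (p : Σ i : Fin m, Fin (n i)) → E p.1) :
    ∑ ε : (Σ i : Fin m, Fin (n i)) → ℤˣ, (∏ p, ((ε p : ℤ) : 𝕜)) •
        T (fun p => ∑ k : Fin (n p.1), ((ε ⟨p.1, k⟩ : ℤ) : 𝕜) • x ⟨p.1, k⟩) =
      ((Fintype.card ((Σ i : Fin m, Fin (n i)) → ℤˣ) * ∏ i, (n i).factorial : ℕ) : 𝕜) • T x := by
  have expand (ε : (Σ i : Fin m, Fin (n i)) → ℤˣ) :
      T (fun p => ∑ k : Fin (n p.1), ((ε ⟨p.1, k⟩ : ℤ) : 𝕜) • x ⟨p.1, k⟩) =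
        ∑ f : (p : Σ i : Fin m, Fin (n i)) → Fin (n p.1),
          (∏ p, ((ε ⟨p.1, f p⟩ : ℤ) : 𝕜)) • T (fun p => x ⟨p.1, f p⟩) := by
    rw [T.map_sum (fun p (k : Fin (n p.1)) => ((ε ⟨p.1, k⟩ : ℤ) : 𝕜) • x ⟨p.1, k⟩)]
    exact Finset.sum_congr rfl fun f _ => T.map_smul_univ _ _
  simp_rw [expand, Finset.smul_sum, smul_smul]
  rw [Finset.sum_comm]
  simp_rw [← Finset.sum_smul]
  rw [← Finset.sum_of_injOn (s := (Finset.univ : Finset ((i : Fin m) → Equiv.Perm (Fin (n i)))))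
    (f := fun _ => (Fintype.card ((Σ i : Fin m, Fin (n i)) → ℤˣ) : 𝕜) • T x)
    (fun σ (p : Σ i : Fin m, Fin (n i)) => σ p.1 p.2)]
  · rw [Finset.sum_const, Finset.card_univ, Fintype.card_pi, ← Nat.cast_smul_eq_nsmul 𝕜, smul_smul]
    simp [Fintype.card_perm, mul_comm]
  · intro σ _ τ _ h
    ext i k
    exact congrArg Fin.val (congrFun h ⟨i, k⟩)
  · simp
  · intro f _ hf
    let g (i : Fin m) (k : Fin (n i)) : Fin (n i) := f ⟨i, k⟩
    obtain ⟨i, hi⟩ : ∃ i, ¬ Function.Surjective (g i) := by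
      by_contra! h
      exact hf ⟨fun i => Equiv.ofBijective (g i) (Finite.surjective_iff_bijective.1 (h i)),
        by simp, rfl⟩
    obtain ⟨k, hk⟩ := not_forall.1 hi
    rw [sum_signs_eq_zero_of_notMem_range (fun p : Σ i : Fin m, Fin (n i) => ⟨p.1, f p⟩)
      (q := ⟨i, k⟩), zero_smul]
    rintro ⟨j, l⟩ h
    obtain rfl : j = i := congrArg Sigma.fst h
    exact hk ⟨l, eq_of_heq (Sigma.mk.inj h).2⟩
  · intro σ _
    dsimp only
    rw [hT σ x]
    exact congrArg (· • T x) (sum_signs_of_perm (𝕜 := 𝕜) (Equiv.sigmaCongrRight σ)).symm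

theorem polyNorm_nonneg (P : ((i : Fin m) → E i) → F) : 0 ≤ polyNorm P :=
  Real.sSup_nonneg (by rintro _ ⟨x, -, rfl⟩; exact norm_nonneg _)

variable {P : ((i : Fin m) → E i) → F}
  {T : ContinuousMultilinearMap 𝕜 (fun p : Σ i : Fin m, Fin (n i) => E p.1) F}

theorem norm_le_norm_of_diagonal (hPT : ∀ x : (i : Fin m) → E i, P x = T (fun p => x p.1))
    {x : (i : Fin m) → E i} (hx : ∀ i, ‖x i‖ ≤ 1) : ‖P x‖ ≤ ‖T‖ := by
  rw [hPT]
  exact T.unit_le_opNorm ((pi_norm_le_iff_of_nonneg zero_le_one).2 fun p => hx p.1)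

theorem norm_le_polyNorm_of_diagonal
    (hPT : ∀ x : (i : Fin m) → E i, P x = T (fun p => x p.1))
    {x : (i : Fin m) → E i} (hx : ∀ i, ‖x i‖ ≤ 1) : ‖P x‖ ≤ polyNorm P := by
  refine le_csSup ⟨‖T‖, ?_⟩ ⟨x, hx, rfl⟩
  rintro _ ⟨y, hy, rfl⟩
  exact norm_le_norm_of_diagonal hPT hy

theorem norm_le_prod_pow_mul_polyNorm (hn : ∀ i, 0 < n i)
    (hPT : ∀ x : (i : Fin m) → E i, P x = T (fun p => x p.1))
    {x : (i : Fin m) → E i} (hx : ∀ i, ‖x i‖ ≤ n i) :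
    ‖P x‖ ≤ ((∏ i, n i ^ n i : ℕ) : ℝ) * polyNorm P := by
  have hx' (i : Fin m) : ‖(n i : 𝕜)⁻¹ • x i‖ ≤ 1 := by
    rw [norm_smul, norm_inv, RCLike.norm_natCast]
    exact inv_mul_le_one_of_le₀ (hx i) (Nat.cast_nonneg _)
  have h : P x = ((∏ i, n i ^ n i : ℕ) : 𝕜) • P fun i => (n i : 𝕜)⁻¹ • x i := by
    have key := T.map_smul_univ (fun p => (n p.1 : 𝕜)) fun p => (n p.1 : 𝕜)⁻¹ • x p.1
    rw [Fintype.prod_sigma] at key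
    simp only [smul_inv_smul₀ (Nat.cast_ne_zero.2 (hn _).ne' : (n _ : 𝕜) ≠ 0)] at key
    rw [hPT, hPT, key]
    simp
  rw [h, norm_smul, RCLike.norm_natCast]
  exact mul_le_mul_of_nonneg_left (norm_le_polyNorm_of_diagonal hPT hx') (Nat.cast_nonneg _)

theorem BlockSymmetric.norm_apply_le_of_unit (hn : ∀ i, 0 < n i) (hT : BlockSymmetric T)
    (hPT : ∀ x : (i : Fin m) → E i, P x = T (fun p => x p.1))
    {x : (p : Σ i : Fin m, Fin (n i)) → E p.1} (hx : ∀ p, ‖x p‖ ≤ 1) :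
    ‖T x‖ ≤ ((∏ i, n i ^ n i : ℕ) : ℝ) / ((∏ i, (n i).factorial : ℕ) : ℝ) * polyNorm P := by
  have sign_norm (u : ℤˣ) : ‖((u : ℤ) : 𝕜)‖ = 1 := by
    rcases Int.units_eq_one_or u with rfl | rfl <;> simp
  have bound := norm_sum_le_of_le Finset.univ
    (f := fun ε : (Σ i : Fin m, Fin (n i)) → ℤˣ => (∏ p, ((ε p : ℤ) : 𝕜)) •
        T (fun p => ∑ k : Fin (n p.1), ((ε ⟨p.1, k⟩ : ℤ) : 𝕜) • x ⟨p.1, k⟩))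
    (n := fun _ => ((∏ i, n i ^ n i : ℕ) : ℝ) * polyNorm P) fun ε _ => by
      rw [norm_smul, norm_prod]
      simp only [sign_norm, Finset.prod_const_one, one_mul]
      rw [← hPT fun i => ∑ k : Fin (n i), ((ε ⟨i, k⟩ : ℤ) : 𝕜) • x ⟨i, k⟩]
      refine norm_le_prod_pow_mul_polyNorm hn hPT fun i => ?_
      refine (norm_sum_le_of_le _ (n := fun _ => (1 : ℝ)) fun k _ => ?_).trans_eq (by simp)
      rw [norm_smul, sign_norm, one_mul]
      exact hx _
  rw [hT.polarization, norm_smul, RCLike.norm_natCast, Finset.sum_const, Finset.card_univ,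
    nsmul_eq_mul, Nat.cast_mul, mul_assoc] at bound
  have hcard : (0 : ℝ) < Fintype.card ((Σ i : Fin m, Fin (n i)) → ℤˣ) :=
    Nat.cast_pos.2 Fintype.card_pos
  have hfact : (0 : ℝ) < ((∏ i, (n i).factorial : ℕ) : ℝ) :=
    Nat.cast_pos.2 (Finset.prod_pos fun i _ => Nat.factorial_pos _)
  rw [div_mul_eq_mul_div, le_div_iff₀ hfact, mul_comm]
  exact le_of_mul_le_mul_left bound hcard

/-- A multilinear map bounded by `C` on the product of unit balls has norm at most `C`. -/
theorem ContinuousMultilinearMap.opNorm_le_of_unit_bound {ι : Type*} [Fintype ι]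
    {G : ι → Type*} [∀ i, NormedAddCommGroup (G i)] [∀ i, NormedSpace 𝕜 (G i)]
    (f : ContinuousMultilinearMap 𝕜 G F) {C : ℝ} (hC : 0 ≤ C)
    (h : ∀ x : (i : ι) → G i, (∀ i, ‖x i‖ ≤ 1) → ‖f x‖ ≤ C) : ‖f‖ ≤ C := by
  refine f.opNorm_le_bound hC fun x => ?_
  have hx : x = fun i => ((‖x i‖ : ℝ) : 𝕜) • (((‖x i‖ : ℝ) : 𝕜)⁻¹ • x i) := by
    ext i
    by_cases hi : x i = 0
    · simp [hi]
    · rw [smul_inv_smul₀ (by simpa using hi)]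
  have hu (i : ι) : ‖((‖x i‖ : ℝ) : 𝕜)⁻¹ • x i‖ ≤ 1 := by
    rw [norm_smul, norm_inv, RCLike.norm_ofReal, abs_norm]
    exact inv_mul_le_one
  calc ‖f x‖ = (∏ i, ‖x i‖) * ‖f fun i => ((‖x i‖ : ℝ) : 𝕜)⁻¹ • x i‖ := by
        conv_lhs => rw [hx, f.map_smul_univ, norm_smul, norm_prod]
        simp
    _ ≤ (∏ i, ‖x i‖) * C :=
        mul_le_mul_of_nonneg_left (h _ hu) (Finset.prod_nonneg fun _ _ => norm_nonneg _)
    _ = C * ∏ i, ‖x i‖ := mul_comm _ _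

end Polarization

/-- If `P : E₁ × ⋯ × Eₘ → F` is a continuous `(n₁,…,nₘ)`-homogeneous polynomial and `P̌` is
its unique associated `(n₁,…,nₘ)`-symmetric continuous `(n₁ + ⋯ + nₘ)`-linear map, then
`‖P‖ ≤ ‖P̌‖ ≤ (n₁^{n₁} ⋯ nₘ^{nₘ} / (n₁! ⋯ nₘ!)) ‖P‖`. -/
theorem polyNorm_le_check_norm_le
    {𝕜 : Type*} [RCLike 𝕜] {m : ℕ} (n : Fin m → ℕ) (hn : ∀ i, 0 < n i)
    {E : Fin m → Type*} [∀ i, NormedAddCommGroup (E i)] [∀ i, NormedSpace 𝕜 (E i)]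
    [∀ i, CompleteSpace (E i)]
    {F : Type*} [NormedAddCommGroup F] [NormedSpace 𝕜 F] [CompleteSpace F]
    (P : ((i : Fin m) → E i) → F) (hP : IsMultipolynomial 𝕜 n P)
    (T : ContinuousMultilinearMap 𝕜 (fun p : Σ i : Fin m, Fin (n i) => E p.1) F)
    (hT : BlockSymmetric T) (hPT : ∀ x : (i : Fin m) → E i, P x = T (fun p => x p.1)) :
    polyNorm P ≤ ‖T‖ ∧
      ‖T‖ ≤ ((∏ i, (n i) ^ (n i) : ℕ) : ℝ) / ((∏ i, Nat.factorial (n i) : ℕ) : ℝ) *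
        polyNorm P := by
  refine ⟨csSup_le ⟨_, 0, by simp, rfl⟩ ?_,
    T.opNorm_le_of_unit_bound (mul_nonneg (by positivity) (polyNorm_nonneg P))
      fun x hx => hT.norm_apply_le_of_unit hn hPT hx⟩
  rintro _ ⟨x, hx, rfl⟩
  exact norm_le_norm_of_diagonal hPT hx
end
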